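/- arXiv:2406.15503 — 5 statements merged into one kernel-verified Lean document; each statement's English description precedes it below -/
import Mathlib

section
/- Let T : [0,1] → ℝ be non-decreasing and right-continuous, and let ν := T_# 𝕌 be the pushforward of the uniform measure on [0,1] by T. Then the generalized inverse of the CDF of ν recovers T: F_ν†(y) = T(y) for every y ∈ [0,1). (This is the inversion formula for the Cumulative Distribution Transform: T ↦ T_#𝕌 inverts ν ↦ F_ν† on its range.) -/
open MeasureTheory Set

/-- The cumulative distribution function (CDF) of a measure `ν` on `ℝ`. -/
noncomputable def Fcdf (ν : Measure ℝ) (x : ℝ) : ℝ := (ν (Iic x)).toReal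

/-- The generalized inverse (quantile function) of the CDF of `ν`. -/
noncomputable def Fq (ν : Measure ℝ) (y : ℝ) : ℝ := sInf {x : ℝ | Fcdf ν x > y}

/-- The Lebesgue measure restricted to `[0,1]` (the uniform measure on `[0,1]`). -/
noncomputable def unif : Measure ℝ := volume.restrict (Icc (0:ℝ) 1)

/-- The CDF of the pushforward of the uniform measure by a measurable map `T` at `x` is the
length of the sublevel set `{T ≤ x}` in `[0,1]`. -/
theorem Fcdf_map_unif {T : ℝ → ℝ} (hT : Measurable T) (x : ℝ) :
    Fcdf (Measure.map T unif) x = volume.real (T ⁻¹' Iic x ∩ Icc 0 1) := by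
  rw [Fcdf, Measure.map_apply hT measurableSet_Iic, unif,
    Measure.restrict_apply (hT measurableSet_Iic), Measure.real]

/-- The CDF of `T_# 𝕌` at `x < T y` is at most `y`. -/
theorem Fcdf_map_unif_le {T : ℝ → ℝ} (hT : Monotone T) {x y : ℝ} (hy : 0 ≤ y) (hx : x < T y) :
    Fcdf (Measure.map T unif) x ≤ y := by
  rw [Fcdf_map_unif hT.measurable]
  have hsub : T ⁻¹' Iic x ∩ Icc 0 1 ⊆ Icc 0 y := fun t ht =>
    ⟨ht.2.1, (hT.reflect_lt (lt_of_le_of_lt ht.1 hx)).le⟩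
  calc volume.real (T ⁻¹' Iic x ∩ Icc 0 1) ≤ volume.real (Icc 0 y) :=
        measureReal_mono hsub measure_Icc_lt_top.ne
    _ = y := by rw [Real.volume_real_Icc_of_le hy, sub_zero]

/-- The CDF of `T_# 𝕌` at `x ≥ T z` is at least `z`. -/
theorem le_Fcdf_map_unif {T : ℝ → ℝ} (hT : Monotone T) {x z : ℝ} (hz : z ∈ Icc (0 : ℝ) 1)
    (hx : T z ≤ x) : z ≤ Fcdf (Measure.map T unif) x := by
  rw [Fcdf_map_unif hT.measurable]
  have hsub : Icc 0 z ⊆ T ⁻¹' Iic x ∩ Icc 0 1 := fun t ht =>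
    ⟨(hT ht.2).trans hx, ht.1, ht.2.trans hz.2⟩
  calc z = volume.real (Icc 0 z) := by rw [Real.volume_real_Icc_of_le hz.1, sub_zero]
    _ ≤ volume.real (T ⁻¹' Iic x ∩ Icc 0 1) :=
        measureReal_mono hsub (measure_ne_top_of_subset inter_subset_right measure_Icc_lt_top.ne)

/-- Inversion formula for the CDT: if `T` is non-decreasing and right-continuous on `[0,1)`,
then the quantile function of `ν := T_# 𝕌` recovers `T` on `[0,1)`. -/
theorem cdt_inversion (T : ℝ → ℝ) (hT : Monotone T)
    (hrc : ∀ y ∈ Ico (0:ℝ) 1, ContinuousWithinAt T (Ici y) y) :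
    ∀ y ∈ Ico (0:ℝ) 1, Fq (Measure.map T unif) y = T y := by
  intro y hy
  have hmem : ∀ w, T y < w → Fcdf (Measure.map T unif) w > y := by
    intro w hw
    have h_near : ∀ᶠ z in nhdsWithin y (Ioi y), T z < w :=
      ((hrc y hy).mono Ioi_subset_Ici_self).eventually_lt_const hw
    obtain ⟨z, hzw, hyz, hz1⟩ := (h_near.and (Ioo_mem_nhdsGT hy.2)).exists
    exact lt_of_lt_of_le hyz (le_Fcdf_map_unif hT ⟨hy.1.trans hyz.le, hz1.le⟩ hzw.le)
  refine csInf_eq_of_forall_ge_of_forall_gt_exists_lt ⟨T y + 1, hmem _ (lt_add_one _)⟩ ?_ ?_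
  · intro x hx
    by_contra! hlt
    exact (Fcdf_map_unif_le hT hy.1 hlt).not_gt hx
  · intro w hw
    obtain ⟨v, hv, hvw⟩ := exists_between hw
    exact ⟨v, hmem v hv, hvw⟩
end

section
/- Uniqueness of monotone transport maps in one dimension: let μ be a probability measure on ℝ absolutely continuous with respect to the Lebesgue measure, and let T₁, T₂ : ℝ → ℝ be non-decreasing (measurable) maps with (T₁)_#μ = (T₂)_#μ. Then T₁ = T₂ μ-almost everywhere. -/
open MeasureTheory Set

/-- Two measurable lower sets of the same finite measure agree almost everywhere, since one of
them contains the other. -/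
lemma IsLowerSet.ae_eq_of_measure_eq {α : Type*} [LinearOrder α] [MeasurableSpace α]
    {μ : Measure α} [IsFiniteMeasure μ] {A B : Set α} (hA : IsLowerSet A) (hB : IsLowerSet B)
    (hAm : MeasurableSet A) (hBm : MeasurableSet B) (h : μ A = μ B) : A =ᵐ[μ] B := by
  rcases hA.total hB with hAB | hBA
  · exact ae_eq_of_subset_of_measure_ge hAB h.ge hAm.nullMeasurableSet (measure_ne_top μ B)
  · exact (ae_eq_of_subset_of_measure_ge hBA h.le hBm.nullMeasurableSet
      (measure_ne_top μ A)).symm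

/-- Monotone maps with the same pushforward of a finite measure are almost everywhere ordered. -/
lemma Monotone.ae_le_of_map_eq {μ : Measure ℝ} [IsFiniteMeasure μ] {S T : ℝ → ℝ}
    (hS : Monotone S) (hT : Monotone T) (h : μ.map S = μ.map T) : S ≤ᵐ[μ] T := by
  have sublevel_ae_eq (q : ℚ) : S ⁻¹' Iic (q : ℝ) =ᵐ[μ] T ⁻¹' Iic (q : ℝ) := by
    refine ((isLowerSet_Iic _).preimage hS).ae_eq_of_measure_eq ((isLowerSet_Iic _).preimage hT)
      (hS.measurable measurableSet_Iic) (hT.measurable measurableSet_Iic) ?_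
    rw [← Measure.map_apply hS.measurable measurableSet_Iic, h,
      Measure.map_apply hT.measurable measurableSet_Iic]
  filter_upwards [ae_all_iff.2 fun q => (sublevel_ae_eq q).mem_iff] with x hx
  by_contra! hlt
  obtain ⟨q, hTq, hqS⟩ := exists_rat_btwn hlt
  exact hqS.not_ge ((hx q).2 hTq.le)

/-- Uniqueness of monotone transport maps in one dimension: if `μ ≪ Leb` and two
non-decreasing maps push `μ` to the same measure, they agree `μ`-a.e. -/
theorem monotone_transport_unique (μ : Measure ℝ) [IsProbabilityMeasure μ]
    (hac : μ ≪ volume) (T₁ T₂ : ℝ → ℝ) (h₁ : Monotone T₁) (h₂ : Monotone T₂)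
    (h : Measure.map T₁ μ = Measure.map T₂ μ) : T₁ =ᵐ[μ] T₂ :=
  (h₁.ae_le_of_map_eq h₂ h).antisymm (h₂.ae_le_of_map_eq h₁ h.symm)
end

section
/- Optimality of the monotone rearrangement in one dimension (Monge side of Brenier's theorem on ℝ): let μ and ν be probability measures on ℝ with finite second moments, μ absolutely continuous with respect to the Lebesgue measure, and set T := F_ν† ∘ F_μ. Then for every measurable map S : ℝ → ℝ with S_#μ = ν one has ∫ |x − T(x)|² dμ(x) ≤ ∫ |x − S(x)|² dμ(x). -/
open MeasureTheory Set

/-- Layer-cake formula for the square of the positive part of a difference. -/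
lemma lintegral_ofReal_sub_sq {α : Type*} [MeasurableSpace α] (μ : Measure α) [SFinite μ]
    {X Y : α → ℝ} (hX : Measurable X) (hY : Measurable Y) :
    ∫⁻ a, ENNReal.ofReal (Y a - X a) ^ 2 ∂μ =
      ∫⁻ p : ℝ × ℝ, μ {a | X a ≤ min p.1 p.2 ∧ max p.1 p.2 < Y a} := by
  set A : Set (α × (ℝ × ℝ)) :=
    {q | X q.1 ≤ min q.2.1 q.2.2 ∧ max q.2.1 q.2.2 < Y q.1} with hA
  have hAm : MeasurableSet A := by
    have h₁ : MeasurableSet {q : α × (ℝ × ℝ) | X q.1 ≤ min q.2.1 q.2.2} :=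
      measurableSet_le (by fun_prop) (by fun_prop)
    have h₂ : MeasurableSet {q : α × (ℝ × ℝ) | max q.2.1 q.2.2 < Y q.1} :=
      measurableSet_lt (by fun_prop) (by fun_prop)
    exact h₁.inter h₂
  calc ∫⁻ a, ENNReal.ofReal (Y a - X a) ^ 2 ∂μ
      = ∫⁻ a, (volume : Measure (ℝ × ℝ)) (Prod.mk a ⁻¹' A) ∂μ := by
        refine lintegral_congr fun a => ?_
        have : Prod.mk a ⁻¹' A = Ico (X a) (Y a) ×ˢ Ico (X a) (Y a) := by
          ext p
          simp only [hA, mem_preimage, mem_ofPred_eq, le_min_iff, max_lt_iff, mem_prod, mem_Ico]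
          tauto
        rw [this, Measure.volume_eq_prod, Measure.prod_prod, Real.volume_Ico, sq]
    _ = ∫⁻ p, μ ((fun a => (a, p)) ⁻¹' A) := by
        rw [← Measure.prod_apply hAm, Measure.prod_apply_symm hAm]
    _ = _ := rfl

lemma ofReal_abs_sub_sq (x y : ℝ) :
    ENNReal.ofReal (|x - y| ^ 2) = ENNReal.ofReal (y - x) ^ 2 + ENNReal.ofReal (x - y) ^ 2 := by
  rw [ENNReal.ofReal_pow (abs_nonneg _)]
  rcases le_total x y with h | h
  · rw [ENNReal.ofReal_of_nonpos (sub_nonpos.2 h), abs_of_nonpos (sub_nonpos.2 h)]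
    simp
  · rw [ENNReal.ofReal_of_nonpos (sub_nonpos.2 h), abs_of_nonneg (sub_nonneg.2 h)]
    simp

/-- The quadratic transport cost in terms of the crossing probabilities. -/
lemma lintegral_ofReal_abs_sub_sq (μ : Measure ℝ) [SFinite μ] {Y : ℝ → ℝ} (hY : Measurable Y) :
    ∫⁻ x, ENNReal.ofReal (|x - Y x| ^ 2) ∂μ =
      (∫⁻ p : ℝ × ℝ, μ {x | x ≤ min p.1 p.2 ∧ max p.1 p.2 < Y x}) +
      ∫⁻ p : ℝ × ℝ, μ {x | Y x ≤ min p.1 p.2 ∧ max p.1 p.2 < x} := by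
  simp_rw [ofReal_abs_sub_sq]
  rw [lintegral_add_left (by fun_prop), lintegral_ofReal_sub_sq μ measurable_id' hY,
    lintegral_ofReal_sub_sq μ hY measurable_id']

lemma exists_pos_lt_ofReal_add_lt {a c : ℝ} {d : ENNReal} (hc : 0 < c)
    (hd : ENNReal.ofReal a < d) : ∃ e, 0 < e ∧ e < c ∧ ENNReal.ofReal (a + e) < d := by
  have ht : Filter.Tendsto (fun e => ENNReal.ofReal (a + e))
      (nhdsWithin 0 (Ioi 0)) (nhds (ENNReal.ofReal a)) := by
    refine (Continuous.tendsto' ?_ 0 _ (by simp)).mono_left nhdsWithin_le_nhds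
    exact ENNReal.continuous_ofReal.comp (by fun_prop)
  obtain ⟨e, he, hed⟩ :=
    (Filter.Eventually.and (Ioo_mem_nhdsGT hc) (ht.eventually_lt_const hd)).exists
  exact ⟨e, he.1, he.2, hed⟩

lemma Fcdf_nonneg (μ : Measure ℝ) (x : ℝ) : 0 ≤ Fcdf μ x := ENNReal.toReal_nonneg

section Fcdf

variable (μ : Measure ℝ) [IsProbabilityMeasure μ]

lemma Fcdf_eq_cdf (x : ℝ) : Fcdf μ x = ProbabilityTheory.cdf μ x := by
  rw [ProbabilityTheory.cdf_eq_real]; rfl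

lemma ofReal_Fcdf (x : ℝ) : ENNReal.ofReal (Fcdf μ x) = μ (Iic x) :=
  ENNReal.ofReal_toReal (measure_ne_top _ _)

lemma Fcdf_mono : Monotone (Fcdf μ) := fun x y h => by
  simpa only [Fcdf_eq_cdf] using ProbabilityTheory.monotone_cdf μ h

lemma Fcdf_le_one (x : ℝ) : Fcdf μ x ≤ 1 := by
  simpa only [Fcdf_eq_cdf] using ProbabilityTheory.cdf_le_one μ x

lemma measure_Ioc_eq_Fcdf (a b : ℝ) : μ (Ioc a b) = ENNReal.ofReal (Fcdf μ b - Fcdf μ a) := by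
  conv_lhs => rw [← ProbabilityTheory.measure_cdf μ]
  rw [StieltjesFunction.measure_Ioc, Fcdf_eq_cdf, Fcdf_eq_cdf]

lemma exists_lt_Fcdf {c : ℝ} (hc : c < 1) : ∃ x, c < Fcdf μ x := by
  simp only [Fcdf_eq_cdf]
  exact ((ProbabilityTheory.tendsto_cdf_atTop μ).eventually_const_lt hc).exists

lemma exists_Fcdf_lt {c : ℝ} (hc : 0 < c) : ∃ x, Fcdf μ x < c := by
  simp only [Fcdf_eq_cdf]
  exact ((ProbabilityTheory.tendsto_cdf_atBot μ).eventually_lt_const hc).exists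

lemma continuous_Fcdf [NullSingletonClass μ] : Continuous (Fcdf μ) := by
  have h : Fcdf μ = ProbabilityTheory.cdf μ := funext (Fcdf_eq_cdf μ)
  rw [h, continuous_iff_continuousAt]
  intro x
  rw [(ProbabilityTheory.monotone_cdf μ).continuousAt_iff_leftLim_eq_rightLim,
    StieltjesFunction.rightLim_eq]
  have h0 : ENNReal.ofReal (ProbabilityTheory.cdf μ x -
      Function.leftLim (ProbabilityTheory.cdf μ) x) = 0 := by
    rw [← StieltjesFunction.measure_singleton, ProbabilityTheory.measure_cdf]
    exact measure_singleton x
  rw [ENNReal.ofReal_eq_zero] at h0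
  exact le_antisymm ((ProbabilityTheory.monotone_cdf μ).leftLim_le le_rfl) (by linarith)

lemma exists_Fcdf_eq [NullSingletonClass μ] {c : ℝ} (h0 : 0 < c) (h1 : c < 1) : ∃ x, Fcdf μ x = c := by
  obtain ⟨a, ha⟩ := exists_Fcdf_lt μ h0
  obtain ⟨b, hb⟩ := exists_lt_Fcdf μ h1
  exact mem_range_of_exists_le_of_exists_ge (continuous_Fcdf μ) ⟨a, ha.le⟩ ⟨b, hb.le⟩

lemma measure_le_and_le_Fcdf [NullSingletonClass μ] (s c : ℝ) :
    μ {x | x ≤ s ∧ c ≤ Fcdf μ x} ≤ ENNReal.ofReal (Fcdf μ s - c) := by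
  rcases lt_or_ge (Fcdf μ s) c with h | h
  · have : {x | x ≤ s ∧ c ≤ Fcdf μ x} = ∅ := by
      ext x
      simp only [mem_ofPred_eq, mem_empty_iff_false, iff_false, not_and, not_le]
      exact fun hx => (Fcdf_mono μ hx).trans_lt h
    simp [this]
  rcases le_or_gt c 0 with hc | hc
  · calc _ ≤ μ (Iic s) := measure_mono fun x hx => hx.1
      _ = ENNReal.ofReal (Fcdf μ s) := (ofReal_Fcdf μ s).symm
      _ ≤ _ := ENNReal.ofReal_le_ofReal (by linarith)
  refine le_of_forall_gt fun d hd => ?_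
  obtain ⟨e, he, hec, hed⟩ := exists_pos_lt_ofReal_add_lt hc hd
  obtain ⟨r, hr⟩ := exists_Fcdf_eq μ (c := c - e) (by linarith)
    (by linarith [Fcdf_le_one μ s])
  refine lt_of_le_of_lt ?_ hed
  rw [show Fcdf μ s - c + e = Fcdf μ s - (c - e) by ring, ← hr, ← measure_Ioc_eq_Fcdf]
  refine measure_mono fun x hx => ⟨?_, hx.1⟩
  by_contra! hxr
  linarith [hx.2, Fcdf_mono μ hxr]

lemma measure_lt_and_Fcdf_le [NullSingletonClass μ] (t c : ℝ) :
    μ {x | t < x ∧ Fcdf μ x ≤ c} ≤ ENNReal.ofReal (c - Fcdf μ t) := by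
  rcases lt_or_ge c (Fcdf μ t) with h | h
  · have : {x | t < x ∧ Fcdf μ x ≤ c} = ∅ := by
      ext x
      simp only [mem_ofPred_eq, mem_empty_iff_false, iff_false, not_and, not_le]
      exact fun hx => h.trans_le (Fcdf_mono μ hx.le)
    simp [this]
  rcases le_or_gt 1 c with hc | hc
  · calc _ ≤ μ (Iic t)ᶜ := measure_mono fun x hx => notMem_Iic.2 hx.1
      _ = ENNReal.ofReal (1 - Fcdf μ t) := by
        rw [prob_compl_eq_one_sub measurableSet_Iic,
          ENNReal.ofReal_sub _ (Fcdf_nonneg μ t), ofReal_Fcdf, ENNReal.ofReal_one]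
      _ ≤ _ := ENNReal.ofReal_le_ofReal (by linarith)
  refine le_of_forall_gt fun d hd => ?_
  obtain ⟨e, he, hec, hed⟩ := exists_pos_lt_ofReal_add_lt (sub_pos.2 hc) hd
  obtain ⟨r, hr⟩ := exists_Fcdf_eq μ (c := c + e) (by linarith [Fcdf_nonneg μ t])
    (by linarith)
  refine lt_of_le_of_lt ?_ hed
  rw [show c - Fcdf μ t + e = c + e - Fcdf μ t by ring, ← hr, ← measure_Ioc_eq_Fcdf]
  refine measure_mono fun x hx => ⟨hx.1, ?_⟩
  by_contra! hxr
  linarith [hx.2, Fcdf_mono μ hxr.le]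

lemma ae_Fcdf_mem_Ioo [NullSingletonClass μ] : ∀ᵐ x ∂μ, Fcdf μ x ∈ Ioo 0 1 := by
  have h1 : ∀ᵐ x : ℝ ∂μ, ∀ n : ℕ, ¬ (x ≤ n ∧ 1 ≤ Fcdf μ x) := by
    rw [ae_all_iff]
    intro n
    rw [ae_iff]
    simp only [not_not]
    refine le_antisymm ((measure_le_and_le_Fcdf μ n 1).trans_eq ?_) zero_le
    exact ENNReal.ofReal_of_nonpos (by linarith [Fcdf_le_one μ n])
  have h0 : ∀ᵐ x : ℝ ∂μ, ∀ n : ℕ, ¬ (-(n : ℝ) < x ∧ Fcdf μ x ≤ 0) := by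
    rw [ae_all_iff]
    intro n
    rw [ae_iff]
    simp only [not_not]
    refine le_antisymm ((measure_lt_and_Fcdf_le μ (-n) 0).trans_eq ?_) zero_le
    exact ENNReal.ofReal_of_nonpos (by linarith [Fcdf_nonneg μ (-n)])
  filter_upwards [h0, h1] with x hx0 hx1
  obtain ⟨n, hn⟩ := exists_nat_ge x
  obtain ⟨m, hm⟩ := exists_nat_gt (-x)
  exact ⟨not_le.1 fun h => hx0 m ⟨by linarith, h⟩, not_le.1 fun h => hx1 n ⟨hn, h⟩⟩

lemma bddBelow_setOf_lt_Fcdf {u : ℝ} (hu : 0 < u) : BddBelow {x | Fcdf μ x > u} := by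
  obtain ⟨a, ha⟩ := exists_Fcdf_lt μ hu
  refine ⟨a, fun x hx => ?_⟩
  by_contra! h
  linarith [Fcdf_mono μ h.le, show Fcdf μ x > u from hx]

lemma Fq_le_of_lt_Fcdf {u t : ℝ} (hu : 0 < u) (h : u < Fcdf μ t) : Fq μ u ≤ t :=
  csInf_le (bddBelow_setOf_lt_Fcdf μ hu) h

lemma le_Fcdf_of_Fq_le {u s : ℝ} (hu : u < 1) (h : Fq μ u ≤ s) : u ≤ Fcdf μ s := by
  by_contra! hlt
  have hright : Filter.Tendsto (Fcdf μ) (nhdsWithin s (Ioi s)) (nhds (Fcdf μ s)) := by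
    have := ((ProbabilityTheory.cdf μ).right_continuous s).mono Ioi_subset_Ici_self
    simpa only [← funext (Fcdf_eq_cdf μ), ContinuousWithinAt] using this
  obtain ⟨r, hr, hsr⟩ := ((hright.eventually_lt_const hlt).and self_mem_nhdsWithin).exists
  have : r ≤ Fq μ u := by
    refine le_csInf (exists_lt_Fcdf μ hu) fun x hx => ?_
    by_contra! hxr
    linarith [Fcdf_mono μ hxr.le, show Fcdf μ x > u from hx]
  exact absurd (this.trans h) (not_le.2 hsr)

lemma monotoneOn_Fq : MonotoneOn (Fq μ) (Ioo 0 1) := fun _ hu _ hv huv =>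
  csInf_le_csInf (bddBelow_setOf_lt_Fcdf μ hu.1) (exists_lt_Fcdf μ hv.2)
    fun _ hx => huv.trans_lt hx

lemma aemeasurable_Fq_Fcdf (ν : Measure ℝ) [IsProbabilityMeasure ν] [NullSingletonClass μ] :
    AEMeasurable (fun x => Fq ν (Fcdf μ x)) μ := by
  have hmeas : MeasurableSet (Fcdf μ ⁻¹' Ioo 0 1) :=
    (Fcdf_mono μ).measurable measurableSet_Ioo
  have h := aemeasurable_restrict_of_monotoneOn (μ := μ) hmeas
    (f := fun x => Fq ν (Fcdf μ x))
    fun x hx y hy hxy => monotoneOn_Fq ν hx hy (Fcdf_mono μ hxy)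
  have hmem : ∀ᵐ x ∂μ, x ∈ Fcdf μ ⁻¹' Ioo 0 1 := ae_Fcdf_mem_Ioo μ
  rwa [Measure.restrict_eq_self_of_ae_mem hmem] at h

lemma measure_le_and_lt_Fq_le (ν : Measure ℝ) [IsProbabilityMeasure ν] [NullSingletonClass μ]
    {T : ℝ → ℝ} (hT : ∀ᵐ x ∂μ, T x = Fq ν (Fcdf μ x)) (s t : ℝ) :
    μ {x | x ≤ s ∧ t < T x} ≤ ENNReal.ofReal (Fcdf μ s - Fcdf ν t) := by
  refine le_trans (measure_mono_ae ?_) (measure_le_and_le_Fcdf μ s (Fcdf ν t))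
  filter_upwards [hT, ae_Fcdf_mem_Ioo μ] with x hTx hx
  rintro ⟨hxs, htx⟩
  refine ⟨hxs, ?_⟩
  by_contra! h
  exact absurd (hTx ▸ htx) (not_lt.2 (Fq_le_of_lt_Fcdf ν hx.1 h))

lemma measure_Fq_le_and_lt_le (ν : Measure ℝ) [IsProbabilityMeasure ν] [NullSingletonClass μ]
    {T : ℝ → ℝ} (hT : ∀ᵐ x ∂μ, T x = Fq ν (Fcdf μ x)) (s t : ℝ) :
    μ {x | T x ≤ s ∧ t < x} ≤ ENNReal.ofReal (Fcdf ν s - Fcdf μ t) := by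
  refine le_trans (measure_mono_ae ?_) (measure_lt_and_Fcdf_le μ t (Fcdf ν s))
  filter_upwards [hT, ae_Fcdf_mem_Ioo μ] with x hTx hx
  rintro ⟨hxs, htx⟩
  exact ⟨htx, le_Fcdf_of_Fq_le ν hx.2 (hTx ▸ hxs)⟩

end Fcdf

/-- Lower bound on crossing probabilities, valid for every coupling. -/
lemma ofReal_Fcdf_sub_le {α : Type*} [MeasurableSpace α] (μ : Measure α) [IsProbabilityMeasure μ]
    {X Y : α → ℝ} (hX : Measurable X) (hY : Measurable Y) (s t : ℝ) :
    ENNReal.ofReal (Fcdf (μ.map X) s - Fcdf (μ.map Y) t) ≤ μ {a | X a ≤ s ∧ t < Y a} := by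
  have := Measure.isProbabilityMeasure_map hX.aemeasurable (μ := μ)
  have := Measure.isProbabilityMeasure_map hY.aemeasurable (μ := μ)
  rw [ENNReal.ofReal_sub _ (Fcdf_nonneg _ t), ofReal_Fcdf, ofReal_Fcdf,
    Measure.map_apply hX measurableSet_Iic, Measure.map_apply hY measurableSet_Iic]
  refine le_measure_sdiff.trans (measure_mono ?_)
  exact fun a ha => ⟨ha.1, not_le.1 ha.2⟩

/-- Optimality of the monotone rearrangement `T = F_ν† ∘ F_μ` for the quadratic cost
among all transport maps from `μ` to `ν`. -/
theorem monotone_rearrangement_optimal (μ ν : Measure ℝ)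
    [IsProbabilityMeasure μ] [IsProbabilityMeasure ν]
    (hμ2 : Integrable (fun x => x ^ 2) μ) (hν2 : Integrable (fun x => x ^ 2) ν)
    (hac : μ ≪ volume)
    (S : ℝ → ℝ) (hSm : Measurable S) (hS : Measure.map S μ = ν) :
    ∫ x, |x - Fq ν (Fcdf μ x)| ^ 2 ∂μ ≤ ∫ x, |x - S x| ^ 2 ∂μ := by
  have : NullSingletonClass μ := ⟨fun x => hac (measure_singleton x)⟩
  have hT := aemeasurable_Fq_Fcdf μ ν
  have hmk : ∀ᵐ x ∂μ, hT.mk _ x = Fq ν (Fcdf μ x) := hT.ae_eq_mk.symm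
  have hle : ∫⁻ x, ENNReal.ofReal (|x - Fq ν (Fcdf μ x)| ^ 2) ∂μ ≤
      ∫⁻ x, ENNReal.ofReal (|x - S x| ^ 2) ∂μ := by
    have hcongr : ∫⁻ x, ENNReal.ofReal (|x - Fq ν (Fcdf μ x)| ^ 2) ∂μ =
        ∫⁻ x, ENNReal.ofReal (|x - hT.mk _ x| ^ 2) ∂μ := by
      refine lintegral_congr_ae ?_
      filter_upwards [hmk] with x hx
      rw [hx]
    rw [hcongr, lintegral_ofReal_abs_sub_sq μ hT.measurable_mk, lintegral_ofReal_abs_sub_sq μ hSm]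
    refine add_le_add (lintegral_mono fun p => ?_) (lintegral_mono fun p => ?_)
    · refine (measure_le_and_lt_Fq_le μ ν hmk _ _).trans ?_
      simpa [hS, Measure.map_id'] using
        ofReal_Fcdf_sub_le μ measurable_id' hSm (min p.1 p.2) (max p.1 p.2)
    · refine (measure_Fq_le_and_lt_le μ ν hmk _ _).trans ?_
      simpa [hS, Measure.map_id'] using
        ofReal_Fcdf_sub_le μ hSm measurable_id' (min p.1 p.2) (max p.1 p.2)
  have hSint : Integrable (fun x => |x - S x| ^ 2) μ := by
    have hX : MemLp (fun x : ℝ => x) 2 μ :=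
      (memLp_two_iff_integrable_sq measurable_id'.aestronglyMeasurable).2 hμ2
    have hS2 : MemLp S 2 μ := by
      refine (memLp_two_iff_integrable_sq hSm.aestronglyMeasurable).2 ?_
      rw [← hS] at hν2
      exact hν2.comp_measurable hSm
    simpa only [sq_abs, Pi.sub_apply] using (hX.sub hS2).integrable_sq
  rw [integral_eq_lintegral_of_nonneg_ae (ae_of_all _ fun x => by positivity)
      (by simp only [sq_abs]
          exact ((aemeasurable_id'.sub hT).pow_const 2).aestronglyMeasurable),
    integral_eq_lintegral_of_nonneg_ae (ae_of_all _ fun x => by positivity)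
      hSint.aestronglyMeasurable]
  refine ENNReal.toReal_mono ?_ hle
  exact hSint.lintegral_lt_top.ne
end

section
/- Geodesic property of the CDT / 1D LOT interpolation: let ν₁, ν₂ be probability measures on a compact interval I ⊂ ℝ, and for t ∈ [0,1] define ρ_t := ((1−t)·F_{ν₁}† + t·F_{ν₂}†)_# 𝕌. Then ρ₀ = ν₁, ρ₁ = ν₂, and for all s, t ∈ [0,1], ‖F_{ρ_t}† − F_{ρ_s}†‖_{L²(𝕌)} = |t − s| · ‖F_{ν₁}† − F_{ν₂}†‖_{L²(𝕌)}; i.e. (ρ_t) is a constant-speed geodesic for the CDT distance d_CDT(σ₁,σ₂) := ‖F_{σ₁}† − F_{σ₂}†‖_{L²([0,1])}. -/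
open MeasureTheory Set

/-- The CDT / 1D LOT displacement interpolation `ρ_t := ((1−t)F_{ν₁}† + tF_{ν₂}†)_# 𝕌`. -/
noncomputable def cdtInterp (ν₁ ν₂ : Measure ℝ) (t : ℝ) : Measure ℝ :=
  Measure.map (fun y => (1 - t) * Fq ν₁ y + t * Fq ν₂ y) unif

theorem Fcdf_eq_cdf_s11 (ν : Measure ℝ) [IsProbabilityMeasure ν] :
    Fcdf ν = ProbabilityTheory.cdf ν := by
  ext x
  rw [ProbabilityTheory.cdf_eq_real]
  rfl

theorem unif_eq_restrict_Ioo : unif = volume.restrict (Ioo (0:ℝ) 1) :=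
  Measure.restrict_congr_set Ioo_ae_eq_Icc.symm

instance isProbabilityMeasure_unif : IsProbabilityMeasure unif := ⟨by simp [unif]⟩

theorem nonempty_lt_Fcdf (ν : Measure ℝ) [IsProbabilityMeasure ν] {y : ℝ} (hy : y < 1) :
    {x : ℝ | Fcdf ν x > y}.Nonempty := by
  rw [Fcdf_eq_cdf_s11]
  exact ((ProbabilityTheory.tendsto_cdf_atTop ν).eventually (lt_mem_nhds hy)).exists

theorem bddBelow_lt_Fcdf (ν : Measure ℝ) [IsProbabilityMeasure ν] {y : ℝ} (hy : 0 < y) :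
    BddBelow {x : ℝ | Fcdf ν x > y} := by
  rw [Fcdf_eq_cdf_s11]
  obtain ⟨m, hm⟩ :=
    ((ProbabilityTheory.tendsto_cdf_atBot ν).eventually (gt_mem_nhds hy)).exists
  refine ⟨m, fun x hx => le_of_not_gt fun hxm => ?_⟩
  exact absurd (hx.trans_le (ProbabilityTheory.monotone_cdf ν hxm.le)) hm.not_gt

theorem Fq_le_of_lt_Fcdf_s11 (ν : Measure ℝ) [IsProbabilityMeasure ν] {x y : ℝ} (hy : 0 < y)
    (h : y < Fcdf ν x) : Fq ν y ≤ x :=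
  csInf_le (bddBelow_lt_Fcdf ν hy) h

theorem le_Fcdf_of_Fq_le_s11 (ν : Measure ℝ) [IsProbabilityMeasure ν] {x y : ℝ} (hy : y < 1)
    (h : Fq ν y ≤ x) : y ≤ Fcdf ν x := by
  have hlt : ∀ z ∈ Ioi x, y ≤ Fcdf ν z := fun z hz => by
    obtain ⟨w, hw, hwz⟩ := exists_lt_of_csInf_lt (nonempty_lt_Fcdf ν hy) (h.trans_lt hz)
    rw [Fcdf_eq_cdf_s11] at *
    exact (show y < _ from hw).le.trans (ProbabilityTheory.monotone_cdf ν hwz.le)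
  rw [Fcdf_eq_cdf_s11] at *
  exact ge_of_tendsto
    (((ProbabilityTheory.cdf ν).right_continuous x).mono_left
      (nhdsWithin_mono x Ioi_subset_Ici_self))
    (Filter.eventually_of_mem self_mem_nhdsWithin hlt)

theorem monotoneOn_Fq_s11 (ν : Measure ℝ) [IsProbabilityMeasure ν] :
    MonotoneOn (Fq ν) (Ioo 0 1) := fun _ hx _ hy hxy =>
  csInf_le_csInf (bddBelow_lt_Fcdf ν hx.1) (nonempty_lt_Fcdf ν hy.2) fun _ hz => hxy.trans_lt hz

theorem aemeasurable_unif_of_monotoneOn {g : ℝ → ℝ} (hg : MonotoneOn g (Ioo 0 1)) :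
    AEMeasurable g unif := by
  rw [unif_eq_restrict_Ioo]
  exact aemeasurable_restrict_of_monotoneOn measurableSet_Ioo hg

theorem map_Iic_unif {g : ℝ → ℝ} (hg : MonotoneOn g (Ioo 0 1)) (x : ℝ) :
    Measure.map g unif (Iic x) = volume (g ⁻¹' Iic x ∩ Ioo 0 1) := by
  rw [Measure.map_apply_of_aemeasurable (aemeasurable_unif_of_monotoneOn hg) measurableSet_Iic,
    unif_eq_restrict_Ioo, Measure.restrict_apply' measurableSet_Ioo]

/-- The quantile function pushes the uniform measure forward to the original measure. -/
theorem map_Fq_unif (ν : Measure ℝ) [IsProbabilityMeasure ν] : Measure.map (Fq ν) unif = ν := by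
  have := Measure.isProbabilityMeasure_map (aemeasurable_unif_of_monotoneOn (monotoneOn_Fq_s11 ν))
  refine Measure.ext_of_Iic _ _ fun x => ?_
  rw [map_Iic_unif (monotoneOn_Fq_s11 ν)]
  have hν : ν (Iic x) = ENNReal.ofReal (Fcdf ν x) := by
    rw [Fcdf, ENNReal.ofReal_toReal (measure_ne_top _ _)]
  have h1 : Fcdf ν x ≤ 1 := by
    rw [Fcdf_eq_cdf_s11]
    exact ProbabilityTheory.cdf_le_one ν x
  rw [hν]
  apply le_antisymm
  · calc volume (Fq ν ⁻¹' Iic x ∩ Ioo 0 1) ≤ volume (Ioc 0 (Fcdf ν x)) :=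
          measure_mono fun y hy => ⟨hy.2.1, le_Fcdf_of_Fq_le_s11 ν hy.2.2 hy.1⟩
      _ = _ := by simp
  · calc ENNReal.ofReal (Fcdf ν x) = volume (Ioo 0 (Fcdf ν x)) := by simp
      _ ≤ volume (Fq ν ⁻¹' Iic x ∩ Ioo 0 1) := measure_mono fun y hy =>
          ⟨Fq_le_of_lt_Fcdf_s11 ν hy.1 hy.2, hy.1, hy.2.trans_le h1⟩

/-- A monotone function on `(0,1)` is almost everywhere the quantile function of its law. -/
theorem Fq_map_unif_ae_eq {g : ℝ → ℝ} (hg : MonotoneOn g (Ioo 0 1)) :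
    Fq (Measure.map g unif) =ᵐ[unif] g := by
  have := Measure.isProbabilityMeasure_map (aemeasurable_unif_of_monotoneOn hg)
  have hF : ∀ x, Fcdf (Measure.map g unif) x = (volume (g ⁻¹' Iic x ∩ Ioo 0 1)).toReal :=
    fun x => by rw [Fcdf, map_Iic_unif hg]
  have hfin : ∀ x, volume (g ⁻¹' Iic x ∩ Ioo 0 1) ≠ ⊤ := fun x =>
    measure_ne_top_of_subset inter_subset_right (by simp)
  have hmem : ∀ᵐ y ∂unif, y ∈ Ioo (0:ℝ) 1 := by
    rw [unif_eq_restrict_Ioo]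
    exact ae_restrict_mem measurableSet_Ioo
  have hcont : ∀ᵐ y ∂unif, y ∉ {y ∈ Ioo (0:ℝ) 1 | ¬ContinuousWithinAt g (Ioo 0 1) y} :=
    ae_restrict_of_ae (hg.countable_not_continuousWithinAt.ae_notMem volume)
  filter_upwards [hcont, hmem] with y hc hy
  have hc : ContinuousWithinAt g (Ioo 0 1) y := not_not.1 fun h => hc ⟨hy, h⟩
  apply le_antisymm
  · refine le_of_forall_gt_imp_ge_of_dense fun x hx => Fq_le_of_lt_Fcdf_s11 _ hy.1 ?_
    have hev := (hc.continuousAt (Ioo_mem_nhds hy.1 hy.2)).eventually (gt_mem_nhds hx)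
    obtain ⟨u, ⟨hux, hu1⟩, hyu⟩ :=
      (((hev.and (gt_mem_nhds hy.2)).filter_mono nhdsWithin_le_nhds).and
        (self_mem_nhdsWithin : Ioi y ∈ nhdsWithin y (Ioi y))).exists
    have hu0 : 0 < u := hy.1.trans hyu
    rw [hF]
    refine lt_of_lt_of_le hyu ((ENNReal.ofReal_le_iff_le_toReal (hfin x)).1 ?_)
    calc ENNReal.ofReal u = volume (Ioc 0 u) := by simp
      _ ≤ volume (g ⁻¹' Iic x ∩ Ioo 0 1) := measure_mono fun v hv =>
        have hv1 : v ∈ Ioo (0:ℝ) 1 := ⟨hv.1, hv.2.trans_lt hu1⟩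
        ⟨(hg hv1 ⟨hu0, hu1⟩ hv.2).trans hux.le, hv1⟩
  · refine le_csInf (nonempty_lt_Fcdf _ hy.2) fun x hx => le_of_not_gt fun hxy => ?_
    have hx : y < Fcdf _ x := hx
    rw [hF] at hx
    refine hx.not_ge (ENNReal.toReal_le_of_le_ofReal hy.1.le ?_)
    calc volume (g ⁻¹' Iic x ∩ Ioo 0 1) ≤ volume (Ioo 0 y) := measure_mono fun v hv =>
          ⟨hv.2.1, lt_of_not_ge fun hyv =>
            absurd ((hg hy hv.2 hyv).trans hv.1) (not_le.2 hxy)⟩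
      _ = _ := by simp

theorem Fq_cdtInterp_ae_eq (ν₁ ν₂ : Measure ℝ) [IsProbabilityMeasure ν₁] [IsProbabilityMeasure ν₂]
    {t : ℝ} (ht : t ∈ Icc (0:ℝ) 1) :
    Fq (cdtInterp ν₁ ν₂ t) =ᵐ[unif] fun y => (1 - t) * Fq ν₁ y + t * Fq ν₂ y :=
  Fq_map_unif_ae_eq fun _ hx _ hy hxy => add_le_add
    (mul_le_mul_of_nonneg_left (monotoneOn_Fq_s11 ν₁ hx hy hxy) (sub_nonneg.2 ht.2))
    (mul_le_mul_of_nonneg_left (monotoneOn_Fq_s11 ν₂ hx hy hxy) ht.1)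

/-- Geodesic property of the CDT: `ρ_t` joins `ν₁` to `ν₂` and is a constant-speed geodesic
for the CDT distance `d(σ₁,σ₂) = ‖F_{σ₁}† − F_{σ₂}†‖_{L²([0,1])}`. -/
theorem cdt_geodesic (a b : ℝ) (hab : a ≤ b)
    (ν₁ ν₂ : Measure ℝ) [IsProbabilityMeasure ν₁] [IsProbabilityMeasure ν₂]
    (h₁ : ν₁ (Icc a b)ᶜ = 0) (h₂ : ν₂ (Icc a b)ᶜ = 0) :
    cdtInterp ν₁ ν₂ 0 = ν₁ ∧ cdtInterp ν₁ ν₂ 1 = ν₂ ∧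
    ∀ s ∈ Icc (0:ℝ) 1, ∀ t ∈ Icc (0:ℝ) 1,
      Real.sqrt (∫ y, |Fq (cdtInterp ν₁ ν₂ t) y - Fq (cdtInterp ν₁ ν₂ s) y| ^ 2 ∂unif)
        = |t - s| * Real.sqrt (∫ y, |Fq ν₁ y - Fq ν₂ y| ^ 2 ∂unif) := by
  refine ⟨by simpa [cdtInterp] using map_Fq_unif ν₁, by simpa [cdtInterp] using map_Fq_unif ν₂,
    fun s hs t ht => ?_⟩
  have hint : ∫ y, |Fq (cdtInterp ν₁ ν₂ t) y - Fq (cdtInterp ν₁ ν₂ s) y| ^ 2 ∂unif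
      = |t - s| ^ 2 * ∫ y, |Fq ν₁ y - Fq ν₂ y| ^ 2 ∂unif := by
    rw [← integral_const_mul]
    refine integral_congr_ae ?_
    filter_upwards [Fq_cdtInterp_ae_eq ν₁ ν₂ ht, Fq_cdtInterp_ae_eq ν₁ ν₂ hs] with y h h'
    simp only [h, h', sq_abs]
    ring
  rw [hint, Real.sqrt_mul (sq_nonneg _), Real.sqrt_sq (abs_nonneg _)]
end

section
/- Identifiability of translation–dilation parameters: let ν be a probability measure on ℝ that is not a Dirac mass, let ω, ω' > 0 and τ, τ' ∈ ℝ, and suppose the pushforwards of ν under the affine maps x ↦ (x+τ)/ω and x ↦ (x+τ')/ω' coincide: (x ↦ (x+τ)/ω)_#ν = (x ↦ (x+τ')/ω')_#ν. Then ω = ω' and τ = τ'. (This justifies that minimizing ‖a·f̂ + b − ĥ‖² in CDT space recovers the true frequency and time-delay parameters uniquely.) -/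
open MeasureTheory Filter Topology ProbabilityTheory Set

/-- A finite invariant measure of a map all of whose orbits converge to `p` is concentrated
at `p`. -/
theorem MeasureTheory.MeasurePreserving.eq_dirac_of_tendsto_iterate {X : Type*}
    [TopologicalSpace X] [MeasurableSpace X] [HasOuterApproxClosed X] [BorelSpace X]
    {ν : Measure X} [IsProbabilityMeasure ν] {T : X → X} (hT : MeasurePreserving T ν ν) {p : X}
    (hp : ∀ x, Tendsto (fun n => T^[n] x) atTop (𝓝 p)) : ν = Measure.dirac p := by
  refine ext_of_forall_integral_eq_of_IsFiniteMeasure fun f => ?_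
  have hinv (n : ℕ) : ∫ x, f (T^[n] x) ∂ν = ∫ x, f x ∂ν := by
    have hn := hT.iterate n
    conv_rhs => rw [← hn.map_eq]
    exact (integral_map hn.aemeasurable f.continuous.measurable.aestronglyMeasurable).symm
  have hlim : Tendsto (fun n : ℕ => ∫ x, f (T^[n] x) ∂ν) atTop (𝓝 (∫ _, f p ∂ν)) := by
    refine tendsto_integral_of_dominated_convergence (fun _ => ‖f‖) (fun n => ?_)
      (integrable_const _) (fun n => ae_of_all _ fun x => f.norm_coe_le_norm _)
      (ae_of_all _ fun x => (f.continuous.tendsto p).comp (hp x))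
    exact (f.continuous.measurable.comp (hT.iterate n).measurable).aestronglyMeasurable
  simp only [hinv] at hlim
  rw [tendsto_nhds_unique tendsto_const_nhds hlim,
    integral_dirac' _ _ f.continuous.measurable.stronglyMeasurable]
  simp

/-- No probability measure on `ℝ` is invariant under a translation by a positive number. -/
theorem not_measurePreserving_add_right_of_pos (ν : Measure ℝ) [IsProbabilityMeasure ν] {b : ℝ}
    (hb : 0 < b) : ¬ MeasurePreserving (fun x => x + b) ν ν := by
  intro hT
  have hstep (x : ℝ) : cdf ν (x + b) = cdf ν x := by
    rw [cdf_eq_real, cdf_eq_real, measureReal_def, measureReal_def,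
      ← hT.measure_preimage measurableSet_Iic.nullMeasurableSet]
    simp
  have hup (n : ℕ) : cdf ν (n * b) = cdf ν 0 := by
    induction n with
    | zero => simp
    | succ k ih => rw [← ih, ← hstep (k * b)]; congr 1; push_cast; ring
  have hdown (n : ℕ) : cdf ν (-(n * b)) = cdf ν 0 := by
    induction n with
    | zero => simp
    | succ k ih => rw [← ih, ← hstep (-((k + 1 : ℕ) * b))]; congr 1; push_cast; ring
  have hatTop : Tendsto (fun n : ℕ => (n : ℝ) * b) atTop atTop :=
    tendsto_natCast_atTop_atTop.atTop_mul_const hb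
  have h1 := (tendsto_cdf_atTop ν).comp hatTop
  have h0 := (tendsto_cdf_atBot ν).comp (tendsto_neg_atTop_atBot.comp hatTop)
  simp only [Function.comp_def, hup] at h1
  simp only [Function.comp_def, hdown] at h0
  exact one_ne_zero (tendsto_nhds_unique h1 h0)

/-- If two affine images of `ν` coincide, then `ν` is invariant under the transition map. -/
theorem measurePreserving_of_map_affine_eq {ν : Measure ℝ} {ω ω' τ τ' : ℝ} (hω' : ω' ≠ 0)
    (h : Measure.map (fun x => (x + τ) / ω) ν = Measure.map (fun x => (x + τ') / ω') ν) :
    MeasurePreserving (fun x => ω' * ((x + τ) / ω) - τ') ν ν := by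
  refine ⟨by fun_prop, ?_⟩
  have hcomp := congrArg (Measure.map fun y => ω' * y - τ') h
  rw [Measure.map_map (by fun_prop) (by fun_prop), Measure.map_map (by fun_prop) (by fun_prop)]
    at hcomp
  have hid : (fun y => ω' * y - τ') ∘ (fun x => (x + τ') / ω') = id := by
    ext x
    simp [mul_div_cancel₀ _ hω']
  rwa [hid, Measure.map_id] at hcomp

/-- A non-Dirac probability measure has no coinciding affine images with distinct dilations. -/
theorem le_of_map_affine_eq {ν : Measure ℝ} [IsProbabilityMeasure ν]
    (hnd : ∀ p : ℝ, ν ≠ Measure.dirac p) {ω ω' τ τ' : ℝ} (hω : 0 < ω) (hω' : 0 < ω')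
    (h : Measure.map (fun x => (x + τ) / ω) ν = Measure.map (fun x => (x + τ') / ω') ν) :
    ω ≤ ω' := by
  by_contra! hlt
  have hpos : 0 < ω' / ω := div_pos hω' hω
  have hc : ContractingWith (ω' / ω).toNNReal (fun x => ω' * ((x + τ) / ω) - τ') := by
    refine ⟨Real.toNNReal_lt_one.2 ((div_lt_one hω).2 hlt),
      LipschitzWith.of_dist_le_mul fun x y => le_of_eq ?_⟩
    rw [Real.coe_toNNReal _ hpos.le, Real.dist_eq, Real.dist_eq, ← abs_of_pos hpos, ← abs_mul]
    congr 1
    ring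
  exact hnd _ ((measurePreserving_of_map_affine_eq hω'.ne' h).eq_dirac_of_tendsto_iterate
    hc.tendsto_iterate_fixedPoint)

/-- Coinciding affine images with the same dilation have ordered translations. -/
theorem le_of_map_affine_eq_of_same_dilation {ν : Measure ℝ} [IsProbabilityMeasure ν]
    {ω τ τ' : ℝ} (hω : ω ≠ 0)
    (h : Measure.map (fun x => (x + τ) / ω) ν = Measure.map (fun x => (x + τ') / ω) ν) :
    τ ≤ τ' := by
  by_contra! hlt
  refine not_measurePreserving_add_right_of_pos ν (sub_pos.2 hlt) ?_
  convert measurePreserving_of_map_affine_eq hω h using 2 with x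
  rw [mul_div_cancel₀ _ hω]
  ring

/-- Identifiability of translation–dilation parameters: if `ν` is a probability measure on `ℝ`
that is not a Dirac mass and the pushforwards of `ν` under `x ↦ (x+τ)/ω` and `x ↦ (x+τ')/ω'`
(with `ω, ω' > 0`) coincide, then `ω = ω'` and `τ = τ'`. -/
theorem affine_parameters_identifiable (ν : Measure ℝ) [IsProbabilityMeasure ν]
    (hnd : ∀ p : ℝ, ν ≠ Measure.dirac p)
    (ω ω' τ τ' : ℝ) (hω : 0 < ω) (hω' : 0 < ω')
    (h : Measure.map (fun x => (x + τ) / ω) ν = Measure.map (fun x => (x + τ') / ω') ν) :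
    ω = ω' ∧ τ = τ' := by
  obtain rfl : ω = ω' :=
    le_antisymm (le_of_map_affine_eq hnd hω hω' h) (le_of_map_affine_eq hnd hω' hω h.symm)
  exact ⟨rfl, le_antisymm (le_of_map_affine_eq_of_same_dilation hω.ne' h)
    (le_of_map_affine_eq_of_same_dilation hω.ne' h.symm)⟩
end
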